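/- Let p ≥ 1 be an integer, r > 0, and let λ be any finite signed Borel measure on ℝ^d. Then ‖λ‖_{ζ_p(r)} ≤ (r^p / p!) · d^{p/2} · ‖λ‖_{TV}. -/

import Mathlib

open MeasureTheory
open scoped RealInnerProductSpace ENNReal NNReal

noncomputable section


/-- The list of coordinate directions encoded by a multi-index `α` on `ℝ^d`:
the direction `i` is repeated `α i` times, so the list has length `|α| = ∑ i, α i`. -/
def multiIndexDirs {d : ℕ} (α : Fin d → ℕ) : List (Fin d) :=
  (List.finRange d).flatMap fun i => List.replicate (α i) i

/-- `D^α u (x)`: the partial derivative of `u` at `x` corresponding to the multi-index `α`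
(of order `|α| = ∑ i, α i`), as an iterated derivative in the coordinate directions. -/
def mderiv {d : ℕ} (α : Fin d → ℕ) (u : EuclideanSpace ℝ (Fin d) → ℝ)
    (x : EuclideanSpace ℝ (Fin d)) : ℝ :=
  iteratedFDeriv ℝ (multiIndexDirs α).length u x
    (fun k => EuclideanSpace.single ((multiIndexDirs α).get k) 1)


/-- The integral `∫ f dλ` of `f` with respect to a finite signed measure `λ`. -/
def sIntegral {X : Type*} [MeasurableSpace X] (lam : SignedMeasure X) (f : X → ℝ) : ℝ :=
  (∫ x, f x ∂lam.toJordanDecomposition.posPart) - ∫ x, f x ∂lam.toJordanDecomposition.negPart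

/-- The total variation norm `‖λ‖_TV` of a finite signed measure `λ`. -/
def tvNorm {X : Type*} [MeasurableSpace X] (lam : SignedMeasure X) : ℝ :=
  (lam.totalVariation Set.univ).toReal


/-- The restricted Zolotarev semi-norm `‖λ‖_{ζ_p(r)}`: the supremum of `|∫ u dλ|` over the
class `U_r` of `C^∞`-smooth functions supported on the closed ball of radius `r` with
`D^α u(0) = 0` for `|α| ≤ p-1` and all partial derivatives of order `p` bounded by `1`. -/
def zolotarevSemiRestricted {d : ℕ} (p : ℕ) (r : ℝ)
    (lam : SignedMeasure (EuclideanSpace ℝ (Fin d))) : ℝ :=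
  sSup { z | ∃ u : EuclideanSpace ℝ (Fin d) → ℝ, ContDiff ℝ (⊤ : ℕ∞) u ∧
    Function.support u ⊆ Metric.closedBall 0 r ∧
    (∀ α : Fin d → ℕ, (∑ i, α i) ≤ p - 1 → mderiv α u 0 = 0) ∧
    (∀ α : Fin d → ℕ, (∑ i, α i) = p → ∀ x, |mderiv α u x| ≤ 1) ∧
    z = |sIntegral lam u| }




theorem zaux_length {d : ℕ} (α : Fin d → ℕ) : (multiIndexDirs α).length = ∑ i, α i := by
  simp [multiIndexDirs, List.length_flatMap, Fin.sum_univ_def]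

theorem zaux_count {d : ℕ} (α : Fin d → ℕ) (i : Fin d) : (multiIndexDirs α).count i = α i := by
  have : (List.map (List.count i ∘ fun j => List.replicate (α j) j) (List.finRange d)).sum
      = ∑ j, (if j = i then α j else 0) := by
    rw [Fin.sum_univ_def]
    congr 1
    apply List.map_congr_left
    intro j _
    simp [List.count_replicate]
  rw [multiIndexDirs, List.count_flatMap, this]
  simp

def zauxG {E : Type*} [NormedAddCommGroup E] [NormedSpace ℝ E] (u : E → ℝ) : List E → E → ℝ
  | [] => u
  | a :: L => fun x => fderiv ℝ (zauxG u L) x a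

theorem zauxG_contDiff {E : Type*} [NormedAddCommGroup E] [NormedSpace ℝ E] (u : E → ℝ)
    (hu : ContDiff ℝ (⊤ : ℕ∞) u) (L : List E) : ContDiff ℝ (⊤ : ℕ∞) (zauxG u L) := by
  induction L with
  | nil => exact hu
  | cons a L ih =>
    exact (ih.fderiv_right (m := (⊤ : ℕ∞)) (by simp)).clm_apply contDiff_const

theorem zauxG_swap {E : Type*} [NormedAddCommGroup E] [NormedSpace ℝ E] (g : E → ℝ)
    (hg : ContDiff ℝ (⊤ : ℕ∞) g) (a b x : E) :
    fderiv ℝ (fun y => fderiv ℝ g y a) x b = fderiv ℝ (fderiv ℝ g) x b a := by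
  have hd : DifferentiableAt ℝ (fderiv ℝ g) x :=
    ((hg.fderiv_right (m := (⊤ : ℕ∞)) (by simp)).differentiable (by simp)) x
  rw [fderiv_clm_apply hd (differentiableAt_const a)]
  simp

theorem zauxG_perm {E : Type*} [NormedAddCommGroup E] [NormedSpace ℝ E] (u : E → ℝ)
    (hu : ContDiff ℝ (⊤ : ℕ∞) u) {L L' : List E} (h : L.Perm L') : zauxG u L = zauxG u L' := by
  induction h with
  | nil => rfl
  | cons a _ ih => simp only [zauxG, ih]
  | swap a b L =>
    ext x
    have hg := zauxG_contDiff u hu L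
    simp only [zauxG]
    rw [zauxG_swap _ hg, zauxG_swap _ hg]
    have hs : IsSymmSndFDerivAt ℝ (zauxG u L) x :=
      hg.contDiffAt.isSymmSndFDerivAt (by simp; exact WithTop.coe_le_coe.2 (le_top : (2 : ℕ∞) ≤ ⊤))
    exact hs _ _
  | trans _ _ ih1 ih2 => exact ih1.trans ih2

theorem zauxG_eq {E : Type*} [NormedAddCommGroup E] [NormedSpace ℝ E] (u : E → ℝ)
    (hu : ContDiff ℝ (⊤ : ℕ∞) u) (n : ℕ) (v : Fin n → E) (x : E) :
    iteratedFDeriv ℝ n u x v = zauxG u (List.ofFn v) x := by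
  induction n generalizing x with
  | zero => simp [zauxG]
  | succ n ih =>
    rw [iteratedFDeriv_succ_apply_left, List.ofFn_succ]
    have e : zauxG u (List.ofFn fun i : Fin n => v i.succ) =
        fun y => iteratedFDeriv ℝ n u y (fun i => v i.succ) := by
      ext y; rw [ih]
    simp only [zauxG, e]
    have hd : DifferentiableAt ℝ (iteratedFDeriv ℝ n u) x :=
      (hu.differentiable_iteratedFDeriv (m := n) (by exact_mod_cast ENat.natCast_lt_top n)) x
    have h := ((ContinuousMultilinearMap.apply ℝ (fun _ : Fin n => E) ℝ
      (fun i => v i.succ)).hasFDerivAt.comp x hd.hasFDerivAt).fderiv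
    have e2 : (fun y => iteratedFDeriv ℝ n u y (fun i => v i.succ)) =
      (ContinuousMultilinearMap.apply ℝ (fun _ : Fin n => E) ℝ (fun i => v i.succ)) ∘
        iteratedFDeriv ℝ n u := by
      ext y; rfl
    rw [e2, h]
    rfl

theorem zaux_deriv {d n : ℕ} (f : Fin n → Fin d) (u : EuclideanSpace ℝ (Fin d) → ℝ)
    (hu : ContDiff ℝ (⊤ : ℕ∞) u) :
    ∃ α : Fin d → ℕ, ∑ i, α i = n ∧ ∀ x,
      iteratedFDeriv ℝ n u x (fun k => EuclideanSpace.single (f k) 1) = mderiv α u x := by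
  set α : Fin d → ℕ := fun i => (List.ofFn f).count i with hα
  have hperm : (List.ofFn f).Perm (multiIndexDirs α) := by
    rw [List.perm_iff_count]
    intro a
    rw [zaux_count]
  refine ⟨α, ?_, ?_⟩
  · rw [← zaux_length, ← hperm.length_eq, List.length_ofFn]
  intro x
  rw [mderiv, zauxG_eq u hu, zauxG_eq u hu]
  refine congrFun (zauxG_perm u hu ?_) x
  have h := hperm.map (fun i => EuclideanSpace.single i (1 : ℝ))
  have h2 : ∀ L : List (Fin d), List.ofFn (fun k => EuclideanSpace.single (L.get k) (1 : ℝ)) =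
      L.map (fun i => EuclideanSpace.single i (1 : ℝ)) := by
    intro L
    conv_rhs => rw [← List.ofFn_get L, List.map_ofFn]
    rfl
  rw [h2]
  rw [List.map_ofFn] at h
  exact h

theorem zaux_expand {d : ℕ} (n : ℕ) (M : ContinuousMultilinearMap ℝ
      (fun _ : Fin n => EuclideanSpace ℝ (Fin d)) ℝ) (x : EuclideanSpace ℝ (Fin d)) :
    M (fun _ => x) = ∑ f : Fin n → Fin d, (∏ k, x (f k)) *
      M (fun k => EuclideanSpace.single (f k) 1) := by
  have hx : x = ∑ i, x i • EuclideanSpace.single i (1 : ℝ) := by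
    ext j
    simp [Pi.single_apply]
  conv_lhs => rw [hx]
  rw [M.map_sum]
  refine Finset.sum_congr rfl fun f _ => ?_
  rw [M.map_smul_univ]
  rfl

theorem zaux_bound {d : ℕ} (n : ℕ) (M : ContinuousMultilinearMap ℝ
      (fun _ : Fin n => EuclideanSpace ℝ (Fin d)) ℝ) (x : EuclideanSpace ℝ (Fin d))
    (C : ℝ) (hM : ∀ f : Fin n → Fin d, |M (fun k => EuclideanSpace.single (f k) 1)| ≤ C) :
    |M (fun _ => x)| ≤ (∑ i, |x i|) ^ n * C := by
  rw [zaux_expand]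
  refine (Finset.abs_sum_le_sum_abs _ _).trans ?_
  have : (∑ i, |x i|) ^ n = ∑ f : Fin n → Fin d, ∏ k, |x (f k)| := by
    have := Finset.prod_univ_sum (fun _ : Fin n => (Finset.univ : Finset (Fin d)))
      (fun _ i => |x i|)
    simpa using this
  rw [this, Finset.sum_mul]
  refine Finset.sum_le_sum fun f _ => ?_
  rw [abs_mul, Finset.abs_prod]
  exact mul_le_mul_of_nonneg_left (hM f) (Finset.prod_nonneg fun _ _ => abs_nonneg _)

theorem zaux_l1 {d : ℕ} (x : EuclideanSpace ℝ (Fin d)) :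
    ∑ i, |x i| ≤ Real.sqrt d * ‖x‖ := by
  rw [EuclideanSpace.norm_eq, ← Real.sqrt_mul (by positivity)]
  apply Real.le_sqrt_of_sq_le
  have := sq_sum_le_card_mul_sum_sq (s := Finset.univ) (f := fun i => |x i|)
  simpa using this

theorem zaux_line {d : ℕ} (u : EuclideanSpace ℝ (Fin d) → ℝ)
    (hu : ContDiff ℝ (⊤ : ℕ∞) u) (x : EuclideanSpace ℝ (Fin d)) (n : ℕ) (t : ℝ) :
    iteratedDeriv n (fun s : ℝ => u (s • x)) t = iteratedFDeriv ℝ n u (t • x) (fun _ => x) := by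
  have := ContinuousLinearMap.iteratedFDeriv_comp_right (n := (⊤ : ℕ∞))
    (ContinuousLinearMap.toSpanSingleton ℝ x) hu t (i := n) (by exact_mod_cast le_top)
  have e : (fun s : ℝ => u (s • x)) = u ∘ (ContinuousLinearMap.toSpanSingleton ℝ x) := by
    ext s; simp
  rw [iteratedDeriv_eq_iteratedFDeriv, e, this]
  simp

theorem zaux_pt {d p : ℕ} (hp : 1 ≤ p) (u : EuclideanSpace ℝ (Fin d) → ℝ)
    (hu : ContDiff ℝ (⊤ : ℕ∞) u)
    (h0 : ∀ α : Fin d → ℕ, (∑ i, α i) ≤ p - 1 → mderiv α u 0 = 0)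
    (h1 : ∀ α : Fin d → ℕ, (∑ i, α i) = p → ∀ x, |mderiv α u x| ≤ 1)
    (x : EuclideanSpace ℝ (Fin d)) :
    |u x| ≤ (Real.sqrt d * ‖x‖) ^ p / (Nat.factorial p : ℝ) := by
  obtain ⟨m, rfl⟩ : ∃ m, p = m + 1 := ⟨p - 1, by omega⟩
  set g : ℝ → ℝ := fun s => u (s • x) with hg
  have hgs : ContDiff ℝ (⊤ : ℕ∞) g := hu.comp (contDiff_id.smul contDiff_const)
  have hgm : ∀ n : ℕ, ContDiff ℝ n g := fun n => hgs.of_le (by exact_mod_cast le_top)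
  obtain ⟨t, -, ht⟩ := taylor_mean_remainder_lagrange_iteratedDeriv (f := g) (n := m)
    (x₀ := 0) (x := 1) (by norm_num) ((hgm (m+1)).contDiffOn)
  have hT : taylorWithinEval g m (Set.uIcc 0 1) 0 1 = 0 := by
    rw [taylor_within_apply]
    refine Finset.sum_eq_zero fun k hk => ?_
    have hk' : k ≤ m := by simpa [Nat.lt_succ_iff] using hk
    rw [iteratedDerivWithin_eq_iteratedDeriv (uniqueDiffOn_uIcc (by norm_num))
      (hgm k).contDiffAt (by simp), zaux_line u hu, zaux_expand]
    rw [Finset.sum_eq_zero, smul_zero]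
    intro f _
    obtain ⟨α, hα, he⟩ := zaux_deriv f u hu
    rw [he, zero_smul, h0 α (by omega), mul_zero]
  rw [hT, zaux_line u hu] at ht
  have hb := zaux_bound (m+1) (iteratedFDeriv ℝ (m+1) u (t • x)) x 1 (by
    intro f
    obtain ⟨α, hα, he⟩ := zaux_deriv f u hu
    rw [he]
    exact h1 α hα _)
  have hgx : g 1 = u x := by simp [hg]
  rw [hgx] at ht
  simp only [sub_zero, one_pow, mul_one] at ht hb
  rw [ht, abs_div, abs_of_nonneg (by positivity : (0:ℝ) ≤ (Nat.factorial (m+1) : ℝ))]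
  gcongr
  exact hb.trans (pow_le_pow_left₀ (by positivity) (zaux_l1 x) _)

/-- The restricted Zolotarev semi-norm of any finite signed measure `λ` on `ℝ^d` satisfies
`‖λ‖_{ζ_p(r)} ≤ (r^p / p!) d^{p/2} ‖λ‖_TV`. -/
theorem zolotarevSemiRestricted_le (d p : ℕ) (hp : 1 ≤ p) (r : ℝ) (hr : 0 < r)
    (lam : SignedMeasure (EuclideanSpace ℝ (Fin d))) :
    zolotarevSemiRestricted p r lam ≤
      r ^ p / (Nat.factorial p : ℝ) * (d : ℝ) ^ ((p : ℝ) / 2) * tvNorm lam := by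
  have hC : 0 ≤ r ^ p / (Nat.factorial p : ℝ) * (d : ℝ) ^ ((p : ℝ) / 2) := by positivity
  unfold zolotarevSemiRestricted
  refine Real.sSup_le ?_ (mul_nonneg hC ENNReal.toReal_nonneg)
  rintro z ⟨u, hu, hs, h0, h1, rfl⟩
  set C := r ^ p / (Nat.factorial p : ℝ) * (d : ℝ) ^ ((p : ℝ) / 2) with hCdef
  have hub : ∀ x, ‖u x‖ ≤ C := by
    intro x
    by_cases hx : u x = 0
    · rw [hx, norm_zero]; exact hC
    have hxr : ‖x‖ ≤ r := by simpa using hs hx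
    refine (zaux_pt hp u hu h0 h1 x).trans ?_
    have hd : (d : ℝ) ^ ((p : ℝ) / 2) = Real.sqrt d ^ p := by
      rw [Real.sqrt_eq_rpow, ← Real.rpow_natCast, ← Real.rpow_mul (by positivity)]
      congr 1; ring
    rw [hCdef, hd, mul_pow, div_mul_eq_mul_div, mul_comm]
    gcongr
  have key : ∀ (μ : Measure (EuclideanSpace ℝ (Fin d))) [IsFiniteMeasure μ],
      |∫ x, u x ∂μ| ≤ C * μ.real Set.univ := by
    intro μ _
    exact norm_integral_le_of_norm_le_const (Filter.Eventually.of_forall hub)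
  have h2 := key lam.toJordanDecomposition.posPart
  have h3 := key lam.toJordanDecomposition.negPart
  have htv : tvNorm lam = lam.toJordanDecomposition.posPart.real Set.univ +
      lam.toJordanDecomposition.negPart.real Set.univ := by
    rw [tvNorm, SignedMeasure.totalVariation, Measure.add_apply,
      ENNReal.toReal_add (measure_ne_top _ _) (measure_ne_top _ _)]
    rfl
  rw [htv, mul_add, sIntegral]
  exact (abs_sub _ _).trans (add_le_add h2 h3)
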